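/- arXiv:2504.11333 — 4 statements merged into one kernel-verified Lean document; each statement's English description precedes it below -/
import Mathlib

section
/- Let I be a nonempty finite set of solution points. For each i ∈ I, let J_i > 0 be the metric Jacobian, ρ^k_i > 0 and ρ^n_i > 0 densities, and for each direction d ∈ {1,2,3} let Δξ_{i,d} > 0 be a flux-point spacing, ρ_{i,d,+} > 0 and ρ_{i,d,−} > 0 neighbor densities, m⁺_{i,d}, m⁻_{i,d} ∈ ℝ momenta, and D⁺_{i,d}, D⁻_{i,d} > 0 dissipation coefficients with D^±_{i,d} ≥ |m^±_{i,d}| / (ρ^k_i + ρ_{i,d,±}). Let Δt > 0, Δτ > 0, C₁ = Δt/(Δt+Δτ), and define for each i the fluxes f⁺_{i,d} = m⁺_{i,d} − D⁺_{i,d}(ρ_{i,d,+} − ρ^k_i), f⁻_{i,d} = m⁻_{i,d} − D⁻_{i,d}(ρ^k_i − ρ_{i,d,−}) and the updated density J_i·ρ^{k+1}_i = C₁·( J_i(ρ^k_i + (Δτ/Δt)ρ^n_i) − Δτ·Σ_{d=1}^{3} (f⁺_{i,d} − f⁻_{i,d})/Δξ_{i,d} ). Assume that for every i ∈ I the quantity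 a_i − b_i is positive, where a_i = (2/J_i)·Σ_{d=1}^{3} (D⁺_{i,d} + D⁻_{i,d})/Δξ_{i,d} and b_i = (1/Δt)·(ρ^n_i/ρ^k_i). If Δτ < min_{i∈I} 1/(a_i − b_i), then ρ^{k+1}_i > 0 for all i ∈ I. -/
open Finset

/-- If the dissipation coefficient `D` is at least `|m| / (r + s)`, then the flux
`m + D * (r - s)` is at most `2 * D * r`. -/
lemma dissipative_flux_le {m D r s : ℝ} (hr : 0 < r) (hs : 0 < s)
    (hD : |m| / (r + s) ≤ D) : m + D * (r - s) ≤ 2 * D * r := by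
  have h : |m| ≤ D * (r + s) := (div_le_iff₀ (by positivity)).mp hD
  linarith [le_abs_self m]

/-- Density positivity of the dual time-stepping BDF1 scheme at
every solution point of a nonempty finite set `I`, under the pseudotime step
bound `Δτ < min_{i∈I} 1/(a_i − b_i)`. -/
theorem bdf1_density_positivity
    {ι : Type*} (I : Finset ι) (hI : I.Nonempty)
    (J ρk ρn ρk1 : ι → ℝ)
    (Δξ ρp ρm mp mm Dp Dm fp fm : ι → Fin 3 → ℝ)
    (Δt Δτ C₁ : ℝ) (hΔt : 0 < Δt) (hΔτ : 0 < Δτ)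
    (hC₁ : C₁ = Δt / (Δt + Δτ))
    (hJ : ∀ i ∈ I, 0 < J i)
    (hρk : ∀ i ∈ I, 0 < ρk i)
    (hρn : ∀ i ∈ I, 0 < ρn i)
    (hΔξ : ∀ i ∈ I, ∀ d : Fin 3, 0 < Δξ i d)
    (hρp : ∀ i ∈ I, ∀ d : Fin 3, 0 < ρp i d)
    (hρm : ∀ i ∈ I, ∀ d : Fin 3, 0 < ρm i d)
    (hDp : ∀ i ∈ I, ∀ d : Fin 3, 0 < Dp i d)
    (hDm : ∀ i ∈ I, ∀ d : Fin 3, 0 < Dm i d)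
    (hDpmin : ∀ i ∈ I, ∀ d : Fin 3, Dp i d ≥ |mp i d| / (ρk i + ρp i d))
    (hDmmin : ∀ i ∈ I, ∀ d : Fin 3, Dm i d ≥ |mm i d| / (ρk i + ρm i d))
    (hfp : ∀ i ∈ I, ∀ d : Fin 3, fp i d = mp i d - Dp i d * (ρp i d - ρk i))
    (hfm : ∀ i ∈ I, ∀ d : Fin 3, fm i d = mm i d - Dm i d * (ρk i - ρm i d))
    (hupdate : ∀ i ∈ I,
      J i * ρk1 i
        = C₁ * (J i * (ρk i + (Δτ / Δt) * ρn i)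
            - Δτ * ∑ d : Fin 3, (fp i d - fm i d) / Δξ i d))
    (a b : ι → ℝ)
    (ha : ∀ i ∈ I, a i = (2 / J i) * ∑ d : Fin 3, (Dp i d + Dm i d) / Δξ i d)
    (hb : ∀ i ∈ I, b i = (1 / Δt) * (ρn i / ρk i))
    (hab : ∀ i ∈ I, 0 < a i - b i)
    (hτ : Δτ < I.inf' hI fun i => 1 / (a i - b i)) :
    ∀ i ∈ I, 0 < ρk1 i := by
  intro i hi
  have hJi := hJ i hi
  have hρi := hρk i hi
  have hflux : ∑ d : Fin 3, (fp i d - fm i d) / Δξ i d ≤ J i * ρk i * a i := by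
    have hsum : J i * ρk i * a i
        = ∑ d : Fin 3, 2 * ρk i * ((Dp i d + Dm i d) / Δξ i d) := by
      rw [ha i hi, ← Finset.mul_sum]
      field_simp
    rw [hsum]
    refine Finset.sum_le_sum fun d _ => ?_
    rw [← mul_div_assoc]
    refine div_le_div_of_nonneg_right ?_ (hΔξ i hi d).le
    have hplus := dissipative_flux_le hρi (hρp i hi d) (hDpmin i hi d)
    have hminus := dissipative_flux_le (m := -mm i d) hρi (hρm i hi d)
      (by simpa only [abs_neg] using hDmmin i hi d)
    rw [hfp i hi d, hfm i hi d]
    linarith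
  have hstep : Δτ * (a i - b i) < 1 :=
    (lt_div_iff₀ (hab i hi)).mp ((Finset.lt_inf'_iff hI).mp hτ i hi)
  have hρn_eq : Δτ / Δt * ρn i = Δτ * (ρk i * b i) := by
    rw [hb i hi]
    field_simp
  have hbracket : 0 < J i * (ρk i + (Δτ / Δt) * ρn i)
      - Δτ * ∑ d : Fin 3, (fp i d - fm i d) / Δξ i d := by
    rw [hρn_eq]
    have hpos := mul_pos (mul_pos hJi hρi) (sub_pos.mpr hstep)
    have hle := mul_le_mul_of_nonneg_left hflux hΔτ.le
    linarith
  have hC₁_pos : 0 < C₁ := by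
    rw [hC₁]
    positivity
  refine pos_of_mul_pos_right ?_ hJi.le
  rw [hupdate i hi]
  exact mul_pos hC₁_pos hbracket
end

section
/- Let J > 0, Δt > 0, ρ^k > 0, ρ^n > 0, and for each direction d ∈ {1,2,3} let Δξ_d > 0, ρ_{d,+} > 0, ρ_{d,−} > 0, m⁺_d, m⁻_d ∈ ℝ, and D⁺_d, D⁻_d > 0 with D^±_d ≥ |m^±_d| / (ρ^k + ρ_{d,±}). Define the fluxes f⁺_d = m⁺_d − D⁺_d(ρ_{d,+} − ρ^k), f⁻_d = m⁻_d − D⁻_d(ρ^k − ρ_{d,−}). If (2/J)·Σ_{d=1}^{3} (D⁺_d + D⁻_d)/Δξ_d ≤ (1/Δt)·(ρ^n/ρ^k), then for every Δτ > 0 the updated density defined by J·ρ^{k+1} = C₁·( J(ρ^k + (Δτ/Δt)ρ^n) − Δτ·Σ_{d=1}^{3} (f⁺_d − f⁻_d)/Δξ_d ), with C₁ = Δt/(Δt+Δτ), satisfies ρ^{k+1} > 0; i.e., no constraint on the pseudotime step is needed to guarantee density positivity. -/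
/-- A first-order mass flux `m - D (σ - ρ)` whose dissipation is at least the minimum admissible
one removes at most `2 D ρ` from the cell of density `ρ`. -/
theorem outgoing_flux_le {ρ σ m D : ℝ} (hρ : 0 < ρ) (hσ : 0 < σ)
    (hD : |m| / (ρ + σ) ≤ D) : m - D * (σ - ρ) ≤ 2 * D * ρ := by
  rw [div_le_iff₀ (add_pos hρ hσ)] at hD
  linarith [le_abs_self m]

/-- If `(2/J)·Σ_d (D⁺_d + D⁻_d)/Δξ_d ≤ (1/Δt)·(ρ^n/ρ^k)`, then the
BDF1 dual time-stepping density update is positive for EVERY pseudotime step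
`Δτ > 0`; no constraint on the pseudotime step is needed. -/
theorem bdf1_density_positivity_unconditional
    (J Δt ρk ρn : ℝ) (hJ : 0 < J) (hΔt : 0 < Δt)
    (hρk : 0 < ρk) (hρn : 0 < ρn)
    (Δξ ρp ρm mp mm Dp Dm fp fm : Fin 3 → ℝ)
    (hΔξ : ∀ d, 0 < Δξ d) (hρp : ∀ d, 0 < ρp d) (hρm : ∀ d, 0 < ρm d)
    (hDp : ∀ d, 0 < Dp d) (hDm : ∀ d, 0 < Dm d)
    (hDpmin : ∀ d, Dp d ≥ |mp d| / (ρk + ρp d))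
    (hDmmin : ∀ d, Dm d ≥ |mm d| / (ρk + ρm d))
    (hfp : ∀ d, fp d = mp d - Dp d * (ρp d - ρk))
    (hfm : ∀ d, fm d = mm d - Dm d * (ρk - ρm d))
    (hnoconstraint :
      (2 / J) * ∑ d : Fin 3, (Dp d + Dm d) / Δξ d ≤ (1 / Δt) * (ρn / ρk)) :
    ∀ Δτ : ℝ, 0 < Δτ → ∀ ρk1 : ℝ,
      J * ρk1
        = (Δt / (Δt + Δτ)) * (J * (ρk + (Δτ / Δt) * ρn)
            - Δτ * ∑ d : Fin 3, (fp d - fm d) / Δξ d) →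
      0 < ρk1 := by
  intro Δτ hΔτ ρk1 hupdate
  have hflux : ∑ d : Fin 3, (fp d - fm d) / Δξ d
      ≤ 2 * ρk * ∑ d : Fin 3, (Dp d + Dm d) / Δξ d := by
    rw [Finset.mul_sum]
    refine Finset.sum_le_sum fun d _ => ?_
    rw [← mul_div_assoc]
    refine div_le_div_of_nonneg_right ?_ (hΔξ d).le
    have hp := outgoing_flux_le hρk (hρp d) (hDpmin d)
    have hm := outgoing_flux_le hρk (hρm d) (m := -mm d) (by simpa using hDmmin d)
    rw [hfp, hfm]
    linarith
  have hdiss : 2 * ρk * ∑ d : Fin 3, (Dp d + Dm d) / Δξ d ≤ J * (ρn / Δt) := by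
    calc 2 * ρk * ∑ d : Fin 3, (Dp d + Dm d) / Δξ d
        = J * ρk * ((2 / J) * ∑ d : Fin 3, (Dp d + Dm d) / Δξ d) := by field_simp
      _ ≤ J * ρk * ((1 / Δt) * (ρn / ρk)) := by gcongr
      _ = J * (ρn / Δt) := by field_simp
  have hbracket : 0 < J * (ρk + (Δτ / Δt) * ρn)
      - Δτ * ∑ d : Fin 3, (fp d - fm d) / Δξ d := by
    have hbound := mul_le_mul_of_nonneg_left (hflux.trans hdiss) hΔτ.le
    have hsplit : J * (ρk + (Δτ / Δt) * ρn) = J * ρk + Δτ * (J * (ρn / Δt)) := by ring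
    linarith [mul_pos hJ hρk]
  refine pos_of_mul_pos_right ?_ hJ.le
  rw [hupdate]
  exact mul_pos (by positivity) hbracket
end

section
/- Let J > 0, Δt > 0, ρ^k > 0, ρ^n > 0, ρ^{n−1} > 0, and for each direction d ∈ {1,2,3} let Δξ_d > 0, ρ_{d,+} > 0, ρ_{d,−} > 0, m⁺_d, m⁻_d ∈ ℝ, and D⁺_d, D⁻_d > 0 with D^±_d ≥ |m^±_d| / (ρ^k + ρ_{d,±}). Define the fluxes f⁺_d = m⁺_d − D⁺_d(ρ_{d,+} − ρ^k), f⁻_d = m⁻_d − D⁻_d(ρ^k − ρ_{d,−}), and for Δτ > 0 define C₂ = 2Δt/(2Δt+3Δτ) and the BDF2 updated density J·ρ^{k+1} = C₂·( J(ρ^k + (2Δτ/Δt)ρ^n − (Δτ/(2Δt))ρ^{n−1}) − Δτ·Σ_{d=1}^{3} (f⁺_d − f⁻_d)/Δξ_d ). Set a = (2/J)·Σ_{d=1}^{3} (D⁺_d + D⁻_d)/Δξ_d and b = (2/Δt)·(ρ^n/ρ^k) − (1/(2Δt))·(ρ^{n−1}/ρ^k). If either a − b ≤ 0, or a − b > 0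 and Δτ < 1/(a − b), then ρ^{k+1} > 0. -/
/-- Dissipation at least `|m| / (r + s)` bounds the mass flux by the dissipative part. -/
lemma abs_le_dissipation_mul {m D r s : ℝ} (hr : 0 < r) (hs : 0 < s)
    (hD : |m| / (r + s) ≤ D) : |m| ≤ D * (r + s) :=
  (div_le_iff₀ (add_pos hr hs)).mp hD

/-- Density positivity of the dual time-stepping BDF2 scheme at a
solution point: if either `a − b ≤ 0`, or `a − b > 0` and `Δτ < 1/(a − b)`,
then the BDF2 updated density is positive. -/
theorem bdf2_density_positivity
    (J Δt ρk ρn ρnm1 : ℝ) (hJ : 0 < J) (hΔt : 0 < Δt)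
    (hρk : 0 < ρk) (hρn : 0 < ρn) (hρnm1 : 0 < ρnm1)
    (Δξ ρp ρm mp mm Dp Dm fp fm : Fin 3 → ℝ)
    (hΔξ : ∀ d, 0 < Δξ d) (hρp : ∀ d, 0 < ρp d) (hρm : ∀ d, 0 < ρm d)
    (hDp : ∀ d, 0 < Dp d) (hDm : ∀ d, 0 < Dm d)
    (hDpmin : ∀ d, Dp d ≥ |mp d| / (ρk + ρp d))
    (hDmmin : ∀ d, Dm d ≥ |mm d| / (ρk + ρm d))
    (hfp : ∀ d, fp d = mp d - Dp d * (ρp d - ρk))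
    (hfm : ∀ d, fm d = mm d - Dm d * (ρk - ρm d))
    (Δτ C₂ : ℝ) (hΔτ : 0 < Δτ) (hC₂ : C₂ = 2 * Δt / (2 * Δt + 3 * Δτ))
    (ρk1 : ℝ)
    (hupdate : J * ρk1
      = C₂ * (J * (ρk + (2 * Δτ / Δt) * ρn - (Δτ / (2 * Δt)) * ρnm1)
          - Δτ * ∑ d : Fin 3, (fp d - fm d) / Δξ d))
    (a b : ℝ)
    (ha : a = (2 / J) * ∑ d : Fin 3, (Dp d + Dm d) / Δξ d)
    (hb : b = (2 / Δt) * (ρn / ρk) - (1 / (2 * Δt)) * (ρnm1 / ρk))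
    (hcase : a - b ≤ 0 ∨ (0 < a - b ∧ Δτ < 1 / (a - b))) :
    0 < ρk1 := by
  have hflux : ∑ d : Fin 3, (fp d - fm d) / Δξ d ≤ J * ρk * a := by
    have hJa : J * ρk * a = ∑ d : Fin 3, 2 * ρk * ((Dp d + Dm d) / Δξ d) := by
      rw [ha, ← Finset.mul_sum]
      field_simp
    rw [hJa]
    refine Finset.sum_le_sum fun d _ => ?_
    rw [← mul_div_assoc]
    refine div_le_div_of_nonneg_right ?_ (hΔξ d).le
    have hp := (abs_le.mp (abs_le_dissipation_mul hρk (hρp d) (hDpmin d))).2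
    have hm := (abs_le.mp (abs_le_dissipation_mul hρk (hρm d) (hDmmin d))).1
    rw [hfp, hfm]
    linarith
  have hstep : Δτ * (a - b) < 1 := by
    rcases hcase with h | ⟨h, hlt⟩
    · exact (mul_nonpos_of_nonneg_of_nonpos hΔτ.le h).trans_lt one_pos
    · exact (lt_div_iff₀ h).mp hlt
  have hhist : J * (ρk + (2 * Δτ / Δt) * ρn - (Δτ / (2 * Δt)) * ρnm1)
      = J * ρk * (1 + Δτ * b) := by
    rw [hb]
    field_simp
    ring
  have hC₂pos : 0 < C₂ := by
    rw [hC₂]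
    positivity
  refine pos_of_mul_pos_right (a := J) ?_ hJ.le
  rw [hupdate, hhist]
  refine mul_pos hC₂pos ?_
  have hgap : 0 < J * ρk * (1 - Δτ * (a - b)) :=
    mul_pos (mul_pos hJ hρk) (sub_pos.mpr hstep)
  linarith [mul_le_mul_of_nonneg_left hflux hΔτ.le]
end

section
/- The admissible set G = { (ρ, m, ρE) ∈ ℝ × ℝ³ × ℝ : ρ > 0 and ρ·(ρE) − ½‖m‖² > 0 } of state vectors with positive density and positive internal energy is a convex subset of ℝ⁵. -/
/-- A state vector `(ρ, m, ρE)`: density, momentum, total energy. -/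
abbrev State : Type := ℝ × (Fin 3 → ℝ) × ℝ

/-- The polar form of `ρ * E - ‖m‖² / 2` is positive on pairs of admissible states. -/
theorem sum_mul_lt_of_admissible {ι : Type*} [Fintype ι] {r s E F : ℝ} {m n : ι → ℝ}
    (hr : 0 < r) (hs : 0 < s) (hE : 0 < r * E - (∑ i, m i ^ 2) / 2)
    (hF : 0 < s * F - (∑ i, n i ^ 2) / 2) :
    ∑ i, m i * n i < r * F + s * E := by
  have hsq : 0 ≤ ∑ i, (s * m i - r * n i) ^ 2 := Finset.sum_nonneg fun i _ => sq_nonneg _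
  have hexpand : ∑ i, (s * m i - r * n i) ^ 2 =
      s ^ 2 * ∑ i, m i ^ 2 - 2 * (r * s) * ∑ i, m i * n i + r ^ 2 * ∑ i, n i ^ 2 := by
    simp only [Finset.mul_sum, ← Finset.sum_sub_distrib, ← Finset.sum_add_distrib]
    exact Finset.sum_congr rfl fun i _ => by ring
  have hE' := mul_pos (pow_pos hs 2) hE
  have hF' := mul_pos (pow_pos hr 2) hF
  refine lt_of_mul_lt_mul_left ?_ (mul_pos hr hs).le
  linarith

/-- The admissible set
`G = {(ρ, m, ρE) : ρ > 0 ∧ ρ·(ρE) − ½‖m‖² > 0}` is convex. -/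
theorem admissible_set_convex :
    Convex ℝ {u : State |
      0 < u.1 ∧ 0 < u.1 * u.2.2 - (∑ i : Fin 3, (u.2.1 i) ^ 2) / 2} := by
  rw [convex_iff_forall_pos]
  rintro ⟨r, m, E⟩ ⟨hr, hE⟩ ⟨s, n, F⟩ ⟨hs, hF⟩ a b ha hb -
  have hcross := mul_pos (mul_pos ha hb) (sub_pos.2 (sum_mul_lt_of_admissible hr hs hE hF))
  have hE' := mul_pos (pow_pos ha 2) hE
  have hF' := mul_pos (pow_pos hb 2) hF
  refine ⟨add_pos (mul_pos ha hr) (mul_pos hb hs), ?_⟩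
  simp only [Fin.sum_univ_three, Prod.smul_mk, Prod.mk_add_mk, smul_eq_mul, Pi.add_apply,
    Pi.smul_apply] at *
  linarith
end
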